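/- Let M, N be positive integers, σ > 0, and let x₁, x₂ ∈ ℝ^N. Define the M×M covariance matrices C_h = (‖x_h‖²/M + σ²)·I for h = 1, 2, and C₃ = (C₁ + C₂)/2. Let PNR_h = ‖x_h‖²/(M σ²) and γ_e = (1 + PNR₁)/(1 + PNR₂). Then (det C₁)^{1/4} · (det C₂)^{1/4} / (det C₃)^{1/2} = (4γ_e/(γ_e + 1)²)^{M/4}. -/

import Mathlib

open Matrix

theorem rpow_quarter_mul_div_rpow_half {a b c : ℝ} (ha : 0 < a) (hb : 0 < b) (hc : 0 < c)
    (n : ℕ) :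
    (a ^ n) ^ ((1 : ℝ) / 4) * (b ^ n) ^ ((1 : ℝ) / 4) / (c ^ n) ^ ((1 : ℝ) / 2)
      = (a * b / c ^ 2) ^ ((n : ℝ) / 4) := by
  have hsq : (c ^ n) ^ ((1 : ℝ) / 2) = ((c ^ 2) ^ n) ^ ((1 : ℝ) / 4) := by
    simp only [← Real.rpow_natCast, ← Real.rpow_mul hc.le]
    congr 1
    push_cast
    ring
  rw [hsq, ← Real.mul_rpow (by positivity) (by positivity),
    ← Real.div_rpow (by positivity) (by positivity), ← mul_pow, ← div_pow,
    ← Real.rpow_natCast, ← Real.rpow_mul (by positivity), mul_one_div]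

/-- The determinant-ratio identity
`|C₁|^{1/4} |C₂|^{1/4} / |C₃|^{1/2} = (4γ_e/(γ_e+1)²)^{M/4}` for the covariance matrices
`C_h = (‖x_h‖²/M + σ²) • I`, `C₃ = (C₁ + C₂)/2`, with `PNR_h = ‖x_h‖²/(Mσ²)` and
`γ_e = (1 + PNR₁)/(1 + PNR₂)`. -/
theorem agots_hellinger_determinant_ratio
    (M N : ℕ) (hM : 0 < M) (hN : 0 < N) (σ : ℝ) (hσ : 0 < σ)
    (x₁ x₂ : EuclideanSpace ℝ (Fin N))
    (C₁ C₂ C₃ : Matrix (Fin M) (Fin M) ℝ)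
    (hC₁ : C₁ = (‖x₁‖ ^ 2 / M + σ ^ 2) • (1 : Matrix (Fin M) (Fin M) ℝ))
    (hC₂ : C₂ = (‖x₂‖ ^ 2 / M + σ ^ 2) • (1 : Matrix (Fin M) (Fin M) ℝ))
    (hC₃ : C₃ = (2⁻¹ : ℝ) • (C₁ + C₂))
    (PNR₁ PNR₂ γe : ℝ)
    (hPNR₁ : PNR₁ = ‖x₁‖ ^ 2 / (M * σ ^ 2))
    (hPNR₂ : PNR₂ = ‖x₂‖ ^ 2 / (M * σ ^ 2))
    (hγe : γe = (1 + PNR₁) / (1 + PNR₂)) :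
    C₁.det ^ ((1 : ℝ) / 4) * C₂.det ^ ((1 : ℝ) / 4) / C₃.det ^ ((1 : ℝ) / 2)
      = (4 * γe / (γe + 1) ^ 2) ^ ((M : ℝ) / 4) := by
  have hM' : (0 : ℝ) < M := by exact_mod_cast hM
  have hpos (x : EuclideanSpace ℝ (Fin N)) : 0 < ‖x‖ ^ 2 / M + σ ^ 2 := by positivity
  have hPNR (x : EuclideanSpace ℝ (Fin N)) :
      1 + ‖x‖ ^ 2 / (M * σ ^ 2) = (‖x‖ ^ 2 / M + σ ^ 2) / σ ^ 2 := by
    field_simp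
    ring
  rw [hPNR₁, hPNR₂, hPNR, hPNR, div_div_div_cancel_right₀ (by positivity)] at hγe
  have ha := hpos x₁
  have hb := hpos x₂
  generalize ‖x₁‖ ^ 2 / M + σ ^ 2 = a at *
  generalize ‖x₂‖ ^ 2 / M + σ ^ 2 = b at *
  have hC₃' : C₃ = ((a + b) / 2) • (1 : Matrix (Fin M) (Fin M) ℝ) := by
    rw [hC₃, hC₁, hC₂, ← add_smul, smul_smul, div_eq_inv_mul]
  simp only [hC₁, hC₂, hC₃', det_smul, det_one, mul_one, Fintype.card_fin]
  rw [rpow_quarter_mul_div_rpow_half ha hb (by positivity), hγe]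
  congr 1
  field_simp
  norm_num
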